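/- There exist ξ₀ ∈ (0,1] and C > 0 such that the reflection coefficient satisfies |R(ξ) − 1| ≤ C ξ and |ξ R'(ξ)| ≤ C ξ for all 0 < ξ ≤ ξ₀. -/

import Mathlib

noncomputable section

open MeasureTheory Complex Filter

/-- The Wronskian `W[f,g](ξ) = f g' − f' g`, evaluated at `x = 0`
(it is independent of `x` for two solutions of the same eigenvalue equation). -/
def Wr (f g : ℝ → ℝ → ℂ) (ξ : ℝ) : ℂ :=
  f 0 ξ * deriv (fun x => g x ξ) 0 - deriv (fun x => f x ξ) 0 * g 0 ξ

/-- `f₋(x,ξ) := f₊(−x,ξ)`. -/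
def fminus (f : ℝ → ℝ → ℂ) : ℝ → ℝ → ℂ := fun x ξ => f (-x) ξ

/-- Reflection coefficient `R(ξ) = W[conj f₋, f₊](ξ) / W[f₊,f₋](ξ)`. -/
def Rcoef (f : ℝ → ℝ → ℂ) (ξ : ℝ) : ℂ :=
  Wr (fun x ξ => (starRingEnd ℂ) (fminus f x ξ)) f ξ / Wr f (fminus f) ξ

/-- If the derivative of `u` is dominated by that of `-B` and both have limits at infinity, then the distance of `u`
to its limit is at most the distance of `B` to its limit. -/
theorem norm_sub_le_of_norm_deriv_le_of_tendsto {F : Type*} [NormedAddCommGroup F]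
    [NormedSpace ℝ F] {u u' : ℝ → F} {B B' : ℝ → ℝ} {L : F} {a b : ℝ}
    (hu : ∀ x, a ≤ x → HasDerivAt u (u' x) x) (hB : ∀ x, a ≤ x → HasDerivAt B (-B' x) x)
    (hle : ∀ x, a ≤ x → ‖u' x‖ ≤ B' x) (hL : Tendsto u atTop (nhds L))
    (hb : Tendsto B atTop (nhds b)) {x : ℝ} (hx : a ≤ x) : ‖u x - L‖ ≤ B x - b := by
  have h1 : ∀ T, x ≤ T → ‖u T - u x‖ ≤ B x - B T := by
    intro T hT
    refine image_norm_le_of_norm_deriv_right_le_deriv_boundary' (f := fun y => u y - u x)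
      (f' := u') (a := x) (b := T) (B := fun y => B x - B y) (B' := B') ?_ ?_ ?_ ?_ ?_ ?_
      (Set.right_mem_Icc.2 hT)
    · intro y hy
      exact (((hu y (hx.trans hy.1)).sub_const _).continuousAt).continuousWithinAt
    · intro y hy
      exact ((hu y (hx.trans hy.1)).sub_const _).hasDerivWithinAt
    · simp
    · intro y hy
      exact (((hB y (hx.trans hy.1)).const_sub _).continuousAt).continuousWithinAt
    · intro y hy
      simpa using ((hB y (hx.trans hy.1)).const_sub (B x)).hasDerivWithinAt
    · intro y hy
      exact hle y (hx.trans hy.1)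
  have h2 : Tendsto (fun T => ‖u T - u x‖) atTop (nhds ‖L - u x‖) := (hL.sub_const _).norm
  have h3 : Tendsto (fun T => B x - B T) atTop (nhds (B x - b)) := hb.const_sub _
  rw [norm_sub_rev]
  exact le_of_tendsto_of_tendsto h2 h3 (eventually_atTop.2 ⟨x, h1⟩)

theorem hasDerivAt_exp_I_mul (c x : ℝ) :
    HasDerivAt (fun y : ℝ => exp (I * c * y)) (I * c * exp (I * c * x)) x := by
  have h : HasDerivAt (fun y : ℝ => I * c * (y : ℂ)) (I * c) x := by
    simpa using (hasDerivAt_id x).ofReal_comp.const_mul (I * (c : ℂ))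
  simpa [mul_comm] using h.cexp

theorem norm_exp_I_mul (c x : ℝ) : ‖exp (I * c * x)‖ = 1 := by
  rw [show I * (c : ℂ) * x = ((c * x : ℝ) : ℂ) * I by push_cast; ring]
  exact norm_exp_ofReal_mul_I _

theorem norm_le_of_rotating_ode {k g : ℝ → ℂ} {B B' : ℝ → ℝ} {σ : ℝ}
    (hk : ∀ x, 0 ≤ x → HasDerivAt k (-(2 * I * σ) * k x + g x) x)
    (hB : ∀ x, 0 ≤ x → HasDerivAt B (-B' x) x) (hle : ∀ x, 0 ≤ x → ‖g x‖ ≤ B' x)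
    (hk0 : Tendsto k atTop (nhds 0)) (hB0 : Tendsto B atTop (nhds 0)) {x : ℝ} (hx : 0 ≤ x) :
    ‖k x‖ ≤ B x := by
  have h := norm_sub_le_of_norm_deriv_le_of_tendsto (a := 0) (L := 0)
    (u := fun y => exp (I * (2 * σ : ℝ) * y) * k y)
    (u' := fun y => exp (I * (2 * σ : ℝ) * y) * g y) ?_ hB ?_ ?_ hB0 hx
  · simpa only [sub_zero, norm_mul, norm_exp_I_mul, one_mul] using h
  · intro y hy
    refine ((hasDerivAt_exp_I_mul (2 * σ) y).mul (hk y hy)).congr_deriv ?_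
    push_cast
    ring
  · intro y hy
    simpa only [norm_mul, norm_exp_I_mul, one_mul] using hle y hy
  · rw [tendsto_zero_iff_norm_tendsto_zero] at hk0 ⊢
    simpa only [norm_mul, norm_exp_I_mul, one_mul] using hk0

theorem hasDerivAt_inv_one_add_pow (n : ℕ) {x : ℝ} (hx : 0 ≤ x) :
    HasDerivAt (fun y : ℝ => 1 / (1 + y) ^ n) (-(n / (1 + x) ^ (n + 1))) x := by
  have h1 : (1 + x) ≠ 0 := by positivity
  have h := (((hasDerivAt_id x).const_add 1).pow n).inv (by simpa using pow_ne_zero n h1)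
  have e : (fun y : ℝ => 1 / (1 + y) ^ n) = (((fun y : ℝ => 1 + id y) ^ n)⁻¹) := by
    ext y; simp
  rw [e]
  refine h.congr_deriv ?_
  rcases n with _ | n
  · simp
  · simp
    field_simp
    ring

theorem tendsto_inv_one_add_pow {n : ℕ} (hn : n ≠ 0) :
    Tendsto (fun y : ℝ => 1 / (1 + y) ^ n) atTop (nhds 0) := by
  simp only [one_div]
  exact ((tendsto_pow_atTop hn).comp (tendsto_atTop_add_const_left _ 1 tendsto_id)).inv_tendsto_atTop

theorem hasDerivAt_exp_div_one_add (c : ℝ) {x : ℝ} (hx : 0 ≤ x) :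
    HasDerivAt (fun y : ℝ => Real.exp (c / (1 + y))) (-(c * Real.exp (c / (1 + x)) / (1 + x) ^ 2))
      x := by
  have h := ((hasDerivAt_inv_one_add_pow 1 hx).const_mul c).exp
  have e : (fun y : ℝ => Real.exp (c / (1 + y))) =
      fun y : ℝ => Real.exp (c * (1 / (1 + y) ^ 1)) := by
    ext y; rw [pow_one, mul_one_div]
  rw [e]
  refine h.congr_deriv ?_
  rw [pow_one, mul_one_div]
  norm_num
  ring

theorem tendsto_exp_div_one_add (c : ℝ) :
    Tendsto (fun y : ℝ => Real.exp (c / (1 + y))) atTop (nhds 1) := by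
  have h := (tendsto_inv_one_add_pow one_ne_zero).const_mul c
  rw [mul_zero] at h
  simpa [div_eq_mul_inv, Function.comp_def] using (Real.continuous_exp.tendsto 0).comp h

/-- A function continuous on `[0, ∞)` with a limit at infinity is bounded there. -/
theorem exists_bound_of_tendsto {d : ℝ → ℂ} {l : ℂ} (hd : ∀ x, 0 ≤ x → ContinuousAt d x)
    (hl : Tendsto d atTop (nhds l)) : ∃ M, ∀ x, 0 ≤ x → ‖d x‖ ≤ M := by
  obtain ⟨X, hX⟩ := eventually_atTop.1 (hl.norm.eventually_le_const (lt_add_one ‖l‖))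
  obtain ⟨M, hM⟩ := (isCompact_Icc (a := (0 : ℝ)) (b := X)).exists_bound_of_continuousOn
    (fun x hx => (hd x hx.1).continuousWithinAt)
  refine ⟨max M (‖l‖ + 1), fun x hx => ?_⟩
  rcases le_total x X with h | h
  · exact (hM x ⟨hx, h⟩).trans (le_max_left _ _)
  · exact (hX x h).trans (le_max_right _ _)

/-- A weighted contraction estimate from infinity for the equation
`∂ₓ²d + 2iσ ∂ₓd = U d + h`. -/
theorem norm_le_of_short_range_ode {U : ℝ → ℝ} {C : ℝ} (hC : 0 ≤ C)
    (hU : ∀ x, 0 ≤ x → |U x| ≤ C / (1 + x) ^ 4) {d k h : ℝ → ℂ} {σ H : ℝ} {l : ℂ} (hH : 0 ≤ H)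
    (hd : ∀ x, 0 ≤ x → HasDerivAt d (k x) x)
    (hk : ∀ x, 0 ≤ x → HasDerivAt k (-(2 * I * σ) * k x + (U x * d x + h x)) x)
    (hh : ∀ x, 0 ≤ x → ‖h x‖ ≤ H / (1 + x) ^ 3)
    (hdl : Tendsto d atTop (nhds l)) (hk0 : Tendsto k atTop (nhds 0)) {x : ℝ} (hx : 0 ≤ x) :
    ‖d x‖ ≤ 2 * (‖l‖ + H) * Real.exp (2 * C + 1) := by
  set c : ℝ := 2 * C + 1 with hc
  have hc0 : 0 < c := by positivity
  have hE1 : ∀ x : ℝ, 0 ≤ x → 1 ≤ Real.exp (c / (1 + x)) := fun x hx =>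
    Real.one_le_exp (by positivity)
  have step : ∀ S : ℝ, (∀ x, 0 ≤ x → ‖d x‖ ≤ S * Real.exp (c / (1 + x))) →
      ∀ x, 0 ≤ x → ‖d x‖ ≤ (‖l‖ + H + S / 2) * Real.exp (c / (1 + x)) := by
    intro S hS
    have hS0 : 0 ≤ S := by
      by_contra! hneg
      have := (norm_nonneg _).trans (hS 0 le_rfl)
      nlinarith [Real.exp_pos (c / (1 + 0))]
    have hkB : ∀ x, 0 ≤ x → ‖k x‖ ≤ S * (C / c) * (Real.exp (c / (1 + x)) * (1 / (1 + x) ^ 2))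
        + H / 2 * (1 / (1 + x) ^ 2) := by
      intro x hx
      refine norm_le_of_rotating_ode (σ := σ)
        (B := fun x => S * (C / c) * (Real.exp (c / (1 + x)) * (1 / (1 + x) ^ 2))
          + H / 2 * (1 / (1 + x) ^ 2))
        (B' := fun x => S * (C / c) * (c * Real.exp (c / (1 + x)) / (1 + x) ^ 4 +
          2 * Real.exp (c / (1 + x)) / (1 + x) ^ 3) + H / (1 + x) ^ 3) hk ?_ ?_ hk0 ?_ hx
      · intro y hy
        refine ((((hasDerivAt_exp_div_one_add c hy).mul
          (hasDerivAt_inv_one_add_pow 2 hy)).const_mul (S * (C / c))).add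
          ((hasDerivAt_inv_one_add_pow 2 hy).const_mul (H / 2))).congr_deriv ?_
        have : 1 + y ≠ 0 := by positivity
        push_cast
        field_simp
        ring
      · intro y hy
        have hy1 : 0 < 1 + y := by positivity
        calc ‖(U y : ℂ) * d y + h y‖ ≤ ‖(U y : ℂ) * d y‖ + ‖h y‖ := norm_add_le _ _
          _ ≤ C / (1 + y) ^ 4 * (S * Real.exp (c / (1 + y))) + H / (1 + y) ^ 3 := by
            rw [norm_mul, norm_real, Real.norm_eq_abs]
            exact add_le_add (mul_le_mul (hU y hy) (hS y hy) (norm_nonneg _) (by positivity))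
              (hh y hy)
          _ = S * (C / c) * (c * Real.exp (c / (1 + y)) / (1 + y) ^ 4) + H / (1 + y) ^ 3 := by
            field_simp
          _ ≤ _ := by
            gcongr
            exact le_add_of_nonneg_right (by positivity)
      · have := (((tendsto_exp_div_one_add c).mul (tendsto_inv_one_add_pow two_ne_zero)).const_mul
          (S * (C / c))).add ((tendsto_inv_one_add_pow two_ne_zero).const_mul (H / 2))
        simpa using this
    intro x hx
    have hdB : ‖d x - l‖ ≤ S * (C / c ^ 2) * Real.exp (c / (1 + x)) + H / 2 * (1 / (1 + x) ^ 1) -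
        S * (C / c ^ 2) := by
      refine norm_sub_le_of_norm_deriv_le_of_tendsto (a := 0) (B := fun x =>
        S * (C / c ^ 2) * Real.exp (c / (1 + x)) + H / 2 * (1 / (1 + x) ^ 1)) hd ?_ hkB hdl ?_ hx
      · intro y hy
        refine (((hasDerivAt_exp_div_one_add c hy).const_mul (S * (C / c ^ 2))).add
          ((hasDerivAt_inv_one_add_pow 1 hy).const_mul (H / 2))).congr_deriv ?_
        have : 1 + y ≠ 0 := by positivity
        push_cast
        field_simp
        ring
      · have := ((tendsto_exp_div_one_add c).const_mul (S * (C / c ^ 2))).add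
          ((tendsto_inv_one_add_pow one_ne_zero).const_mul (H / 2))
        simpa using this
    have hCc : C / c ^ 2 ≤ 1 / 2 := by
      rw [div_le_div_iff₀ (by positivity) (by norm_num), hc]
      nlinarith [sq_nonneg C]
    have h1 : (1 : ℝ) / (1 + x) ^ 1 ≤ 1 := by
      rw [pow_one]
      exact div_le_one_of_le₀ (by linarith) (by positivity)
    have h2 : ‖d x‖ ≤ ‖l‖ + ‖d x - l‖ := by
      simpa using norm_add_le l (d x - l)
    have h3 : 0 ≤ C / c ^ 2 := by positivity
    have h4 : S * (C / c ^ 2) * Real.exp (c / (1 + x)) ≤ S * (1 / 2) * Real.exp (c / (1 + x)) := by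
      gcongr
    have h5 := hE1 x hx
    have h6 : 0 ≤ ‖l‖ := norm_nonneg l
    have h7 : 0 ≤ S * (C / c ^ 2) := by positivity
    nlinarith
  obtain ⟨M, hM⟩ := exists_bound_of_tendsto (fun x hx => (hd x hx).continuousAt) hdl
  have hM0 : 0 ≤ M := (norm_nonneg _).trans (hM 0 le_rfl)
  have hbdd : BddAbove (Set.range fun x : Set.Ici (0 : ℝ) =>
      ‖d x‖ / Real.exp (c / (1 + (x : ℝ)))) := by
    refine ⟨M, ?_⟩
    rintro _ ⟨x, rfl⟩
    exact div_le_of_le_mul₀ (Real.exp_pos _).le hM0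
      ((hM x x.2).trans (le_mul_of_one_le_right hM0 (hE1 x x.2)))
  set S : ℝ := ⨆ x : Set.Ici (0 : ℝ), ‖d x‖ / Real.exp (c / (1 + (x : ℝ))) with hSdef
  have hS : ∀ x, 0 ≤ x → ‖d x‖ ≤ S * Real.exp (c / (1 + x)) := by
    intro x hx
    rw [← div_le_iff₀ (Real.exp_pos _)]
    exact le_ciSup hbdd (⟨x, hx⟩ : Set.Ici (0 : ℝ))
  have hS2 : S ≤ ‖l‖ + H + S / 2 := by
    have : Nonempty (Set.Ici (0 : ℝ)) := ⟨⟨0, Set.self_mem_Ici⟩⟩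
    refine ciSup_le fun x => ?_
    rw [div_le_iff₀ (Real.exp_pos _)]
    exact step S hS x x.2
  calc ‖d x‖ ≤ S * Real.exp (c / (1 + x)) := hS x hx
    _ ≤ 2 * (‖l‖ + H) * Real.exp c := by
      have h0 : 0 ≤ ‖l‖ + H := by positivity
      refine mul_le_mul (by linarith) (Real.exp_le_exp.2 ?_) (Real.exp_pos _).le (by positivity)
      exact div_le_self hc0.le (by linarith)

/-- `e^{iσx} m` is the Jost solution of `-g'' + U g = σ² g` on `[0, ∞)`, and `k` is the
derivative of `m`. -/
structure IsJostPair (U : ℝ → ℝ) (σ : ℝ) (m k : ℝ → ℂ) : Prop where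
  hasDerivAt_fst : ∀ x, 0 ≤ x → HasDerivAt m (k x) x
  hasDerivAt_snd : ∀ x, 0 ≤ x → HasDerivAt k (-(2 * I * σ) * k x + U x * m x) x
  tendsto_fst : Tendsto m atTop (nhds 1)
  tendsto_snd : Tendsto k atTop (nhds 0)

theorem hasDerivAt_conj {u : ℝ → ℂ} {u' : ℂ} {x : ℝ} (h : HasDerivAt u u' x) :
    HasDerivAt (fun y => (starRingEnd ℂ) (u y)) ((starRingEnd ℂ) u') x := h.star

theorem IsJostPair.conj {U : ℝ → ℝ} {σ : ℝ} {m k : ℝ → ℂ} (h : IsJostPair U σ m k) :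
    IsJostPair U (-σ) (fun x => (starRingEnd ℂ) (m x)) (fun x => (starRingEnd ℂ) (k x)) where
  hasDerivAt_fst x hx := hasDerivAt_conj (h.hasDerivAt_fst x hx)
  hasDerivAt_snd x hx := (hasDerivAt_conj (h.hasDerivAt_snd x hx)).congr_deriv (by simp [conj_ofNat])
  tendsto_fst := by
    simpa [Function.comp_def] using (continuous_conj.tendsto 1).comp h.tendsto_fst
  tendsto_snd := by
    simpa [Function.comp_def] using (continuous_conj.tendsto 0).comp h.tendsto_snd

theorem exists_bound_of_isJostPair {U : ℝ → ℝ} {C : ℝ} (hC : 0 ≤ C)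
    (hU : ∀ x, 0 ≤ x → |U x| ≤ C / (1 + x) ^ 4) :
    ∃ K, 0 < K ∧ ∀ σ m k, IsJostPair U σ m k → ∀ x, 0 ≤ x →
      ‖m x‖ ≤ K ∧ ‖k x‖ ≤ K / (1 + x) ^ 3 ∧ ‖m x - 1‖ ≤ K / (1 + x) ^ 2 := by
  set M : ℝ := 2 * Real.exp (2 * C + 1) with hM
  have hM0 : 0 < M := by positivity
  refine ⟨M + M * C, by positivity, fun σ m k h => ?_⟩
  have hm : ∀ x, 0 ≤ x → ‖m x‖ ≤ M := by
    intro x hx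
    have := norm_le_of_short_range_ode hC hU (σ := σ) (h := fun _ => 0) le_rfl h.hasDerivAt_fst
      (fun x hx => (h.hasDerivAt_snd x hx).congr_deriv (by simp)) (by simp) h.tendsto_fst
      h.tendsto_snd hx
    simpa [hM] using this
  have hk : ∀ x, 0 ≤ x → ‖k x‖ ≤ M * C / 3 * (1 / (1 + x) ^ 3) := by
    intro x hx
    refine norm_le_of_rotating_ode (B := fun x => M * C / 3 * (1 / (1 + x) ^ 3))
      (B' := fun x => M * C / (1 + x) ^ 4) h.hasDerivAt_snd ?_ ?_ h.tendsto_snd ?_ hx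
    · intro y hy
      refine ((hasDerivAt_inv_one_add_pow 3 hy).const_mul (M * C / 3)).congr_deriv ?_
      push_cast
      ring
    · intro y hy
      rw [norm_mul, norm_real, Real.norm_eq_abs, mul_comm M C, mul_div_right_comm]
      exact mul_le_mul (hU y hy) (hm y hy) (norm_nonneg _) (by positivity)
    · simpa using (tendsto_inv_one_add_pow three_ne_zero).const_mul (M * C / 3)
  have hm1 : ∀ x, 0 ≤ x → ‖m x - 1‖ ≤ M * C / 6 * (1 / (1 + x) ^ 2) - 0 := by
    intro x hx
    refine norm_sub_le_of_norm_deriv_le_of_tendsto (a := 0)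
      (B := fun x => M * C / 6 * (1 / (1 + x) ^ 2)) h.hasDerivAt_fst ?_ hk h.tendsto_fst ?_ hx
    · intro y hy
      refine ((hasDerivAt_inv_one_add_pow 2 hy).const_mul (M * C / 6)).congr_deriv ?_
      push_cast
      ring
    · simpa using (tendsto_inv_one_add_pow two_ne_zero).const_mul (M * C / 6)
  have hMC : 0 ≤ M * C := by positivity
  refine fun x hx => ⟨(hm x hx).trans (by linarith), (hk x hx).trans ?_, (hm1 x hx).trans ?_⟩
  · rw [mul_one_div]
    gcongr
    linarith
  · rw [sub_zero, mul_one_div]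
    gcongr
    linarith

theorem exists_lipschitz_of_isJostPair {U : ℝ → ℝ} {C : ℝ} (hC : 0 ≤ C)
    (hU : ∀ x, 0 ≤ x → |U x| ≤ C / (1 + x) ^ 4) :
    ∃ L, 0 < L ∧ ∀ σ τ m₁ k₁ m₂ k₂, IsJostPair U σ m₁ k₁ → IsJostPair U τ m₂ k₂ → ∀ x, 0 ≤ x →
      ‖m₁ x - m₂ x‖ ≤ L * |σ - τ| ∧ ‖k₁ x - k₂ x‖ ≤ L * |σ - τ| := by
  obtain ⟨K, hK, hb⟩ := exists_bound_of_isJostPair hC hU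
  set D : ℝ := 4 * K * Real.exp (2 * C + 1) with hD
  have hD0 : 0 < D := by positivity
  refine ⟨D + (C * D + 2 * K), by positivity, fun σ τ m₁ k₁ m₂ k₂ h₁ h₂ => ?_⟩
  have hd : ∀ x, 0 ≤ x → HasDerivAt (fun x => m₁ x - m₂ x) (k₁ x - k₂ x) x := fun x hx =>
    (h₁.hasDerivAt_fst x hx).sub (h₂.hasDerivAt_fst x hx)
  have hk : ∀ x, 0 ≤ x → HasDerivAt (fun x => k₁ x - k₂ x) (-(2 * I * σ) * (k₁ x - k₂ x) +
      (U x * (m₁ x - m₂ x) + -(2 * I * (σ - τ : ℝ)) * k₂ x)) x := fun x hx =>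
    ((h₁.hasDerivAt_snd x hx).sub (h₂.hasDerivAt_snd x hx)).congr_deriv (by push_cast; ring)
  have hh : ∀ x, 0 ≤ x → ‖-(2 * I * (σ - τ : ℝ)) * k₂ x‖ ≤ 2 * K * |σ - τ| / (1 + x) ^ 3 := by
    intro x hx
    rw [norm_mul, norm_neg, norm_mul, norm_mul, norm_real, Real.norm_eq_abs, norm_I, mul_one,
      norm_ofNat]
    calc 2 * |σ - τ| * ‖k₂ x‖ ≤ 2 * |σ - τ| * (K / (1 + x) ^ 3) := by
          gcongr
          exact (hb τ m₂ k₂ h₂ x hx).2.1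
      _ = _ := by ring
  have hdl : Tendsto (fun x => m₁ x - m₂ x) atTop (nhds 0) := by
    simpa using h₁.tendsto_fst.sub h₂.tendsto_fst
  have hk0 : Tendsto (fun x => k₁ x - k₂ x) atTop (nhds 0) := by
    simpa using h₁.tendsto_snd.sub h₂.tendsto_snd
  have hdD : ∀ x, 0 ≤ x → ‖m₁ x - m₂ x‖ ≤ D * |σ - τ| := by
    intro x hx
    have := norm_le_of_short_range_ode hC hU (by positivity) hd hk hh hdl hk0 hx
    rw [norm_zero, zero_add] at this
    exact this.trans_eq (by rw [hD]; ring)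
  have hkD : ∀ x, 0 ≤ x → ‖k₁ x - k₂ x‖ ≤ (C * D + 2 * K) * |σ - τ| / 2 * (1 / (1 + x) ^ 2) := by
    intro x hx
    refine norm_le_of_rotating_ode
      (B := fun x => (C * D + 2 * K) * |σ - τ| / 2 * (1 / (1 + x) ^ 2))
      (B' := fun x => (C * D + 2 * K) * |σ - τ| / (1 + x) ^ 3) hk ?_ ?_ hk0 ?_ hx
    · intro y hy
      refine ((hasDerivAt_inv_one_add_pow 2 hy).const_mul _).congr_deriv ?_
      push_cast
      ring
    · intro y hy
      have h34 : C / (1 + y) ^ 4 ≤ C / (1 + y) ^ 3 := by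
        gcongr
        · linarith
        · norm_num
      refine (norm_add_le _ _).trans ?_
      calc ‖(U y : ℂ) * (m₁ y - m₂ y)‖ + ‖-(2 * I * (σ - τ : ℝ)) * k₂ y‖
          ≤ C / (1 + y) ^ 3 * (D * |σ - τ|) + 2 * K * |σ - τ| / (1 + y) ^ 3 := by
            rw [norm_mul (U y : ℂ), norm_real, Real.norm_eq_abs]
            exact add_le_add (mul_le_mul ((hU y hy).trans h34) (hdD y hy) (norm_nonneg _)
              (by positivity)) (hh y hy)
        _ = _ := by ring
    · simpa using (tendsto_inv_one_add_pow two_ne_zero).const_mul ((C * D + 2 * K) * |σ - τ| / 2)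
  intro x hx
  have hp : 0 ≤ (C * D + 2 * K) * |σ - τ| := by positivity
  have hq : 0 ≤ D * |σ - τ| := by positivity
  refine ⟨(hdD x hx).trans (by linarith), (hkD x hx).trans ?_⟩
  have h1 : 1 / (1 + x) ^ 2 ≤ 1 :=
    div_le_one_of_le₀ (one_le_pow₀ (by linarith)) (by positivity)
  nlinarith

theorem nonneg_of_deriv_nonpos_of_tendsto {g g' : ℝ → ℝ} {a : ℝ}
    (hg : ∀ x, a ≤ x → HasDerivAt g (g' x) x) (hg' : ∀ x, a ≤ x → g' x ≤ 0)
    (h0 : Tendsto g atTop (nhds 0)) {x : ℝ} (hx : a ≤ x) : 0 ≤ g x := by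
  have hanti : AntitoneOn g (Set.Ici a) := by
    refine antitoneOn_of_hasDerivWithinAt_nonpos (f' := g') (convex_Ici a)
      (fun y hy => (hg y hy).continuousAt.continuousWithinAt) ?_ ?_
    · intro y hy
      exact (hg y (interior_subset hy)).hasDerivWithinAt
    · intro y hy
      exact hg' y (interior_subset hy)
  refine le_of_tendsto h0 ?_
  filter_upwards [eventually_ge_atTop x] with y hy
  exact hanti hx (hx.trans hy) hy

/-- `∫_x^∞ (1 + t²)⁻² dt`. -/
def tailIntegral (x : ℝ) : ℝ := (Real.pi / 2 - Real.arctan x - x / (1 + x ^ 2)) / 2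

/-- The solution of `∂ₓ²φ = 2 φ / (1 + x²)` decaying at `+∞`. -/
def decayingSolution (x : ℝ) : ℝ := (1 + x ^ 2) * tailIntegral x

/-- The derivative of `decayingSolution`. -/
def decayingSolutionDeriv (x : ℝ) : ℝ := x * (Real.pi / 2 - Real.arctan x) - 1

/-- The logarithmic derivative of `decayingSolution`. -/
def superpotential (x : ℝ) : ℝ := decayingSolutionDeriv x / decayingSolution x

/-- The supersymmetric partner of the potential `2 / (1 + x²)`. -/
def partnerPotential (x : ℝ) : ℝ := 2 * superpotential x ^ 2 - 2 / (1 + x ^ 2)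

theorem hasDerivAt_tailIntegral (x : ℝ) :
    HasDerivAt tailIntegral (-(1 / (1 + x ^ 2) ^ 2)) x := by
  have h0 : 1 + x ^ 2 ≠ 0 := by positivity
  have h1 : HasDerivAt (fun y : ℝ => 1 + y ^ 2) (2 * x) x := by
    simpa using ((hasDerivAt_id x).pow 2).const_add 1
  refine ((((Real.hasDerivAt_arctan x).const_sub (Real.pi / 2)).sub
    ((hasDerivAt_id x).div h1 h0)).div_const 2).congr_deriv ?_
  simp only [id]
  field_simp
  ring

theorem tendsto_tailIntegral : Tendsto tailIntegral atTop (nhds 0) := by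
  have h1 : Tendsto (fun x : ℝ => x / (1 + x ^ 2)) atTop (nhds 0) := by
    refine squeeze_zero' (g := fun x : ℝ => x⁻¹) ?_ ?_ tendsto_inv_atTop_zero
    · filter_upwards [eventually_ge_atTop 0] with x hx
      positivity
    · filter_upwards [eventually_gt_atTop 0] with x hx
      rw [div_le_iff₀ (by positivity)]
      field_simp
      linarith
  have h2 := (((Real.tendsto_arctan_atTop.mono_right nhdsWithin_le_nhds).const_sub
    (Real.pi / 2)).sub h1).div_const 2
  rw [sub_self, sub_zero, zero_div] at h2
  exact h2

theorem hasDerivAt_inv_pow (n : ℕ) {x : ℝ} (hx : x ≠ 0) :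
    HasDerivAt (fun y : ℝ => 1 / y ^ n) (-(n / x ^ (n + 1))) x := by
  have h := ((hasDerivAt_id x).pow n).inv (by simpa using pow_ne_zero n hx)
  have e : (fun y : ℝ => 1 / y ^ n) = ((id : ℝ → ℝ) ^ n)⁻¹ := by
    ext y; simp
  rw [e]
  refine h.congr_deriv ?_
  rcases n with _ | n
  · simp
  · simp
    field_simp
    ring

theorem tendsto_inv_pow {n : ℕ} (hn : n ≠ 0) :
    Tendsto (fun y : ℝ => 1 / y ^ n) atTop (nhds 0) := by
  simp only [one_div]
  exact (tendsto_pow_atTop hn).inv_tendsto_atTop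

theorem tailIntegral_pos {x : ℝ} (hx : 0 ≤ x) : 0 < tailIntegral x := by
  have h := nonneg_of_deriv_nonpos_of_tendsto (a := 0)
    (g := fun x => tailIntegral x - 1 / 3 * (1 / (1 + x) ^ 3))
    (g' := fun x => 1 / (1 + x) ^ 4 - 1 / (1 + x ^ 2) ^ 2) ?_ ?_ ?_ hx
  · have : 0 < 1 / 3 * (1 / (1 + x) ^ 3) := by positivity
    linarith
  · intro y hy
    refine ((hasDerivAt_tailIntegral y).sub
      ((hasDerivAt_inv_one_add_pow 3 hy).const_mul (1 / 3))).congr_deriv ?_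
    push_cast
    ring
  · intro y hy
    rw [sub_nonpos]
    apply one_div_le_one_div_of_le (by positivity)
    calc (1 + y ^ 2) ^ 2 ≤ ((1 + y) ^ 2) ^ 2 := by
          gcongr
          nlinarith
      _ = _ := by ring
  · simpa only [mul_zero, sub_zero] using tendsto_tailIntegral.sub
      ((tendsto_inv_one_add_pow three_ne_zero).const_mul (1 / 3))

theorem tailIntegral_le {x : ℝ} (hx : 1 ≤ x) : tailIntegral x ≤ 1 / 3 * (1 / x ^ 3) := by
  have h := nonneg_of_deriv_nonpos_of_tendsto (a := 1)
    (g := fun x => 1 / 3 * (1 / x ^ 3) - tailIntegral x)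
    (g' := fun x => 1 / (1 + x ^ 2) ^ 2 - 1 / x ^ 4) ?_ ?_ ?_ hx
  · linarith
  · intro y hy
    refine (((hasDerivAt_inv_pow 3 (by positivity)).const_mul (1 / 3)).sub
      (hasDerivAt_tailIntegral y)).congr_deriv ?_
    push_cast
    ring
  · intro y hy
    rw [sub_nonpos]
    apply one_div_le_one_div_of_le (by positivity)
    nlinarith [sq_nonneg y]
  · simpa only [mul_zero, sub_zero] using
      ((tendsto_inv_pow three_ne_zero).const_mul (1 / 3)).sub tendsto_tailIntegral

theorem le_tailIntegral {x : ℝ} (hx : 1 ≤ x) :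
    1 / 3 * (1 / x ^ 3) - 2 / 5 * (1 / x ^ 5) ≤ tailIntegral x := by
  have h := nonneg_of_deriv_nonpos_of_tendsto (a := 1)
    (g := fun x => tailIntegral x - (1 / 3 * (1 / x ^ 3) - 2 / 5 * (1 / x ^ 5)))
    (g' := fun x => 1 / x ^ 4 - 2 / x ^ 6 - 1 / (1 + x ^ 2) ^ 2) ?_ ?_ ?_ hx
  · linarith
  · intro y hy
    have hy0 : y ≠ 0 := by positivity
    refine ((hasDerivAt_tailIntegral y).sub (((hasDerivAt_inv_pow 3 hy0).const_mul (1 / 3)).sub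
      ((hasDerivAt_inv_pow 5 hy0).const_mul (2 / 5)))).congr_deriv ?_
    push_cast
    ring
  · intro y hy
    have hy0 : 0 < y := by positivity
    have e : 1 / y ^ 4 - 2 / y ^ 6 = (y ^ 2 - 2) / y ^ 6 := by
      field_simp
    rw [sub_nonpos, e, div_le_div_iff₀ (by positivity) (by positivity)]
    nlinarith [sq_nonneg y]
  · simpa only [mul_zero, sub_zero] using tendsto_tailIntegral.sub (((tendsto_inv_pow three_ne_zero).const_mul (1 / 3)).sub
      ((tendsto_inv_pow (n := 5) (by norm_num)).const_mul (2 / 5)))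

theorem decayingSolution_pos {x : ℝ} (hx : 0 ≤ x) : 0 < decayingSolution x :=
  mul_pos (by positivity) (tailIntegral_pos hx)

theorem decayingSolutionDeriv_eq (x : ℝ) :
    decayingSolutionDeriv x = 2 * x * tailIntegral x - 1 / (1 + x ^ 2) := by
  unfold decayingSolutionDeriv tailIntegral
  field_simp
  ring

theorem hasDerivAt_decayingSolution (x : ℝ) :
    HasDerivAt decayingSolution (decayingSolutionDeriv x) x := by
  have h1 : HasDerivAt (fun y : ℝ => 1 + y ^ 2) (2 * x) x := by
    simpa using ((hasDerivAt_id x).pow 2).const_add 1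
  refine (h1.mul (hasDerivAt_tailIntegral x)).congr_deriv ?_
  rw [decayingSolutionDeriv_eq]
  field_simp
  ring

theorem hasDerivAt_decayingSolutionDeriv (x : ℝ) :
    HasDerivAt decayingSolutionDeriv (2 / (1 + x ^ 2) * decayingSolution x) x := by
  refine (((hasDerivAt_id x).mul ((Real.hasDerivAt_arctan x).const_sub (Real.pi / 2))).sub_const
    1).congr_deriv ?_
  simp only [decayingSolution, tailIntegral, id]
  field_simp
  ring

/-- The Riccati equation `∂ₓw = V - w²`. -/
theorem hasDerivAt_superpotential {x : ℝ} (hx : 0 ≤ x) :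
    HasDerivAt superpotential (2 / (1 + x ^ 2) - superpotential x ^ 2) x := by
  have h := (decayingSolution_pos hx).ne'
  refine ((hasDerivAt_decayingSolutionDeriv x).div (hasDerivAt_decayingSolution x) h).congr_deriv ?_
  unfold superpotential
  field_simp

theorem abs_superpotential_add_inv_le {x : ℝ} (hx : 2 ≤ x) :
    |superpotential x + 1 / x| ≤ 10 / x ^ 3 := by
  have hx0 : 0 < x := by linarith
  have hφ := decayingSolution_pos hx0.le
  have hu := tailIntegral_le (x := x) (by linarith)
  have hl := le_tailIntegral (x := x) (by linarith)
  set T := tailIntegral x with hT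
  have hxφ : 1 / 5 ≤ x * decayingSolution x := by
    have h1 : x ^ 3 * (1 / 3 * (1 / x ^ 3) - 2 / 5 * (1 / x ^ 5)) ≤ x ^ 3 * T := by gcongr
    have h2 : x ^ 3 * (1 / 3 * (1 / x ^ 3) - 2 / 5 * (1 / x ^ 5)) = 1 / 3 - 2 / 5 * (1 / x ^ 2) := by
      field_simp
    have h3 : 1 / x ^ 2 ≤ 1 / 2 ^ 2 := by gcongr
    have h4 : 0 < x * T := mul_pos hx0 (tailIntegral_pos hx0.le)
    have h5 : x * decayingSolution x = x * T + x ^ 3 * T := by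
      rw [decayingSolution]; ring
    linarith
  have hN : |x * decayingSolutionDeriv x + decayingSolution x| ≤ 2 / x ^ 3 := by
    have e : x * decayingSolutionDeriv x + decayingSolution x = (1 + 3 * x ^ 2) * T
        - x / (1 + x ^ 2) := by
      rw [decayingSolutionDeriv_eq, decayingSolution]
      ring
    rw [e, abs_le]
    have h1 : 1 / x - 1 / x ^ 3 ≤ x / (1 + x ^ 2) := by
      rw [show 1 / x - 1 / x ^ 3 = (x ^ 2 - 1) / x ^ 3 by field_simp,
        div_le_div_iff₀ (by positivity) (by positivity)]
      nlinarith
    have h2 : x / (1 + x ^ 2) ≤ 1 / x := by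
      rw [div_le_div_iff₀ (by positivity) (by positivity)]
      nlinarith
    have h3 : (1 + 3 * x ^ 2) * T ≤ (1 + 3 * x ^ 2) * (1 / 3 * (1 / x ^ 3)) := by gcongr
    have h4 : (1 + 3 * x ^ 2) * (1 / 3 * (1 / x ^ 3) - 2 / 5 * (1 / x ^ 5)) ≤
        (1 + 3 * x ^ 2) * T := by gcongr
    have h5 : (1 + 3 * x ^ 2) * (1 / 3 * (1 / x ^ 3)) = 1 / x + 1 / 3 * (1 / x ^ 3) := by
      field_simp
      ring
    have h6 : (1 + 3 * x ^ 2) * (1 / 3 * (1 / x ^ 3) - 2 / 5 * (1 / x ^ 5)) =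
        1 / x - (13 / 15) * (1 / x ^ 3) - 2 / 5 * (1 / x ^ 5) := by
      field_simp
      ring
    have h7 : 1 / x ^ 5 ≤ 1 / x ^ 3 := by
      gcongr
      · linarith
      · norm_num
    have h8 : 0 < 1 / x ^ 3 := by positivity
    have h9 : 2 / x ^ 3 = 2 * (1 / x ^ 3) := by ring
    constructor <;> linarith
  have e : superpotential x + 1 / x =
      (x * decayingSolutionDeriv x + decayingSolution x) / (x * decayingSolution x) := by
    unfold superpotential
    field_simp
  rw [e, abs_div, abs_of_pos (mul_pos hx0 hφ), div_le_iff₀ (mul_pos hx0 hφ)]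
  refine hN.trans ?_
  calc 2 / x ^ 3 = 10 / x ^ 3 * (1 / 5) := by ring
    _ ≤ _ := by gcongr

theorem exists_partnerPotential_bound :
    ∃ C, 0 ≤ C ∧ ∀ x, 0 ≤ x → |partnerPotential x| ≤ C / (1 + x) ^ 4 := by
  have hcont : ContinuousOn (fun x => (1 + x) ^ 4 * partnerPotential x) (Set.Icc 0 2) := by
    have hw : ContinuousOn superpotential (Set.Icc 0 2) := fun x hx =>
      (hasDerivAt_superpotential hx.1).continuousAt.continuousWithinAt
    unfold partnerPotential
    refine ContinuousOn.mul (by fun_prop) (((hw.pow 2).const_mul 2).sub ?_)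
    exact ContinuousOn.div (by fun_prop) (by fun_prop) fun x _ => by positivity
  obtain ⟨M, hM⟩ := isCompact_Icc.exists_bound_of_continuousOn hcont
  refine ⟨max M 500, le_max_of_le_right (by norm_num), fun x hx => ?_⟩
  rw [le_div_iff₀' (by positivity)]
  rcases le_total x 2 with h | h
  · have := hM x ⟨hx, h⟩
    rw [Real.norm_eq_abs, abs_mul, abs_of_pos (by positivity)] at this
    exact this.trans (le_max_left _ _)
  · refine le_trans ?_ (le_max_right _ _)
    have hx0 : 0 < x := by linarith
    have h1 := abs_superpotential_add_inv_le h
    have h2 : 10 / x ^ 3 ≤ 5 / 2 * (1 / x) := by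
      rw [mul_one_div, div_le_div_iff₀ (by positivity) (by positivity)]
      nlinarith [mul_le_mul h h (by norm_num) hx, mul_nonneg hx hx]
    have h3 : |superpotential x - 1 / x| ≤ 9 / 2 * (1 / x) := by
      have : superpotential x - 1 / x = (superpotential x + 1 / x) - 2 * (1 / x) := by ring
      rw [this]
      refine (abs_sub _ _).trans ?_
      rw [abs_of_pos (show 0 < 2 * (1 / x) by positivity)]
      linarith
    have h4 : |1 / x ^ 2 - 1 / (1 + x ^ 2)| ≤ 1 / x ^ 4 := by
      rw [show 1 / x ^ 2 - 1 / (1 + x ^ 2) = 1 / (x ^ 2 * (1 + x ^ 2)) by field_simp; ring,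
        abs_of_pos (by positivity)]
      apply one_div_le_one_div_of_le (by positivity)
      nlinarith
    have e : partnerPotential x = 2 * ((superpotential x + 1 / x) * (superpotential x - 1 / x))
        + 2 * (1 / x ^ 2 - 1 / (1 + x ^ 2)) := by
      unfold partnerPotential
      field_simp
      ring
    have h5 : |partnerPotential x| ≤ 2 * (10 / x ^ 3 * (9 / 2 * (1 / x))) + 2 * (1 / x ^ 4) := by
      rw [e]
      refine (abs_add_le _ _).trans ?_
      rw [abs_mul, abs_mul, abs_mul, abs_two]
      gcongr
    calc (1 + x) ^ 4 * |partnerPotential x|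
        ≤ (3 / 2 * x) ^ 4 * (2 * (10 / x ^ 3 * (9 / 2 * (1 / x))) + 2 * (1 / x ^ 4)) := by
          gcongr
          linarith
      _ ≤ 500 := by
          field_simp
          norm_num

theorem tendsto_superpotential : Tendsto superpotential atTop (nhds 0) := by
  have h1 : Tendsto (fun x : ℝ => 10 / x ^ 3) atTop (nhds 0) := by
    simpa only [mul_one_div, mul_zero] using (tendsto_inv_pow three_ne_zero).const_mul (10 : ℝ)
  have h2 : Tendsto (fun x => superpotential x + 1 / x) atTop (nhds 0) := by
    refine squeeze_zero_norm' ?_ h1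
    filter_upwards [eventually_ge_atTop 2] with x hx
    exact abs_superpotential_add_inv_le hx
  have h3 : Tendsto (fun x : ℝ => 1 / x) atTop (nhds 0) := by
    simpa using tendsto_inv_atTop_zero (𝕜 := ℝ)
  simpa using h2.sub h3

/-- The Darboux transformation of the Jost solution of the potential `2 / (1 + x²)`. -/
theorem exists_isJostPair_of_jost {ξ : ℝ} (hξ : 0 < ξ) {f g : ℝ → ℂ}
    (hf : ∀ x, HasDerivAt f (g x) x)
    (hg : ∀ x, HasDerivAt g ((((2 / (1 + x ^ 2) : ℝ) : ℂ) - (ξ : ℂ) ^ 2) * f x) x)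
    (hf0 : Tendsto (fun x : ℝ => exp (-I * x * ξ) * f x) atTop (nhds 1))
    (hg0 : Tendsto (fun x : ℝ => exp (-I * x * ξ) * g x) atTop (nhds (I * ξ))) :
    ∃ m k, IsJostPair partnerPotential ξ m k ∧
      I * ξ * f 0 = k 0 + (I * ξ + superpotential 0) * m 0 ∧
      g 0 = superpotential 0 * f 0 + I * ξ * m 0 := by
  have hξ' : (ξ : ℂ) ≠ 0 := by exact_mod_cast hξ.ne'
  have hIξ : I * (ξ : ℂ) ≠ 0 := mul_ne_zero I_ne_zero hξ'
  have hE : ∀ x : ℝ, exp (I * (-ξ : ℝ) * x) = exp (-I * x * ξ) := fun x => by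
    congr 1; push_cast; ring
  have hw : ∀ x, 0 ≤ x → HasDerivAt (fun y : ℝ => (superpotential y : ℂ))
      (((2 / (1 + x ^ 2) : ℝ) : ℂ) - (superpotential x : ℂ) ^ 2) x := fun x hx =>
    (hasDerivAt_superpotential hx).ofReal_comp.congr_deriv (by push_cast; ring)
  have hw0 : Tendsto (fun y : ℝ => (superpotential y : ℂ)) atTop (nhds 0) := by
    simpa [Function.comp_def] using (continuous_ofReal.tendsto 0).comp tendsto_superpotential
  set e : ℝ → ℂ := fun x => (g x - superpotential x * f x) / (I * ξ) with he
  have hIe : ∀ x, I * ξ * e x = g x - superpotential x * f x := fun x => by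
    simp only [he]
    field_simp
  have hde : ∀ x, 0 ≤ x → HasDerivAt e (I * ξ * f x - superpotential x * e x) x := by
    intro x hx
    refine (((hg x).sub ((hw x hx).mul (hf x))).div_const (I * ξ)).congr_deriv ?_
    rw [div_eq_iff hIξ]
    linear_combination (superpotential x : ℂ) * hIe x - (ξ : ℂ) ^ 2 * f x * I_sq
  have hm0 : Tendsto (fun x : ℝ => exp (I * (-ξ : ℝ) * x) * e x) atTop (nhds 1) := by
    have h := (hg0.sub (hw0.mul hf0)).div_const (I * ξ)
    rw [zero_mul, sub_zero, div_self hIξ] at h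
    refine h.congr fun x => ?_
    rw [hE]
    simp only [he]
    ring
  refine ⟨fun x => exp (I * (-ξ : ℝ) * x) * e x,
    fun x => exp (I * (-ξ : ℝ) * x) * (I * ξ * f x - superpotential x * e x - I * ξ * e x),
    ⟨fun x hx => ?_, fun x hx => ?_, hm0, ?_⟩, ?_, ?_⟩
  · refine ((hasDerivAt_exp_I_mul (-ξ) x).mul (hde x hx)).congr_deriv ?_
    push_cast
    ring
  · refine ((hasDerivAt_exp_I_mul (-ξ) x).mul ((((hf x).const_mul (I * (ξ : ℂ))).sub
      ((hw x hx).mul (hde x hx))).sub ((hde x hx).const_mul (I * (ξ : ℂ))))).congr_deriv ?_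
    have hg' : g x = superpotential x * f x + I * ξ * e x := by rw [hIe]; ring
    rw [hg', partnerPotential]
    simp only [Pi.sub_apply, Pi.mul_apply]
    push_cast
    ring
  · have h := ((hf0.const_mul (I * (ξ : ℂ))).sub (hw0.mul hm0)).sub (hm0.const_mul (I * (ξ : ℂ)))
    rw [zero_mul, sub_zero, sub_self] at h
    refine h.congr fun x => ?_
    rw [← hE]
    ring
  · simp only [ofReal_zero, mul_zero, exp_zero, one_mul]
    ring
  · simp only [ofReal_zero, mul_zero, exp_zero, one_mul, hIe]
    ring

theorem superpotential_zero_ne_zero : superpotential 0 ≠ 0 := by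
  refine div_ne_zero ?_ (decayingSolution_pos le_rfl).ne'
  simp [decayingSolutionDeriv]

theorem exists_lower_bound_of_isJostPair :
    ∃ c ξ₁ : ℝ, 0 < c ∧ 0 < ξ₁ ∧ ξ₁ ≤ 1 ∧ ∀ ξ m k, 0 < ξ → ξ ≤ ξ₁ →
      IsJostPair partnerPotential ξ m k →
      c ≤ ‖k 0 + (I * ξ + superpotential 0) * m 0‖ := by
  obtain ⟨C, hC, hU⟩ := exists_partnerPotential_bound
  obtain ⟨K, hK, hb⟩ := exists_bound_of_isJostPair hC hU
  set X : ℝ := 10 + 16 * K with hX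
  have hX10 : 10 ≤ X := by linarith
  have hX0 : 0 < X := by linarith
  have hφc : ContinuousOn (fun x => (decayingSolution x)⁻¹) (Set.Icc 0 X) := fun x hx =>
    ((hasDerivAt_decayingSolution x).continuousAt.inv₀
      (decayingSolution_pos hx.1).ne').continuousWithinAt
  obtain ⟨M, hM⟩ := isCompact_Icc.exists_bound_of_continuousOn hφc
  have hM0 : 0 ≤ M := (norm_nonneg _).trans (hM 0 ⟨le_rfl, hX0.le⟩)
  have hφX := decayingSolution_pos hX0.le
  have hφ0 := decayingSolution_pos (le_refl (0 : ℝ))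
  set c₂ : ℝ := 1 / (2 * X) / decayingSolution X with hc₂
  have hc₂0 : 0 < c₂ := by positivity
  refine ⟨c₂ / 2 * decayingSolution 0, min 1 (min (1 / (10 * K * X)) (c₂ / (2 * (K * M * X + 1)))),
    by positivity, by positivity, min_le_left _ _, fun ξ m k hξ hξ₁ h => ?_⟩
  have hξ1 : ξ ≤ 1 := hξ₁.trans (min_le_left _ _)
  have hξ2 : ξ ≤ 1 / (10 * K * X) := hξ₁.trans ((min_le_right _ _).trans (min_le_left _ _))
  have hξ3 : ξ ≤ c₂ / (2 * (K * M * X + 1)) :=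
    hξ₁.trans ((min_le_right _ _).trans (min_le_right _ _))
  set P : ℝ → ℂ := fun x => exp (I * ξ * x) * (k x + (I * ξ + superpotential x) * m x) with hP
  have hdP : ∀ x, 0 ≤ x →
      HasDerivAt P (superpotential x * P x - (ξ : ℂ) ^ 2 * (exp (I * ξ * x) * m x)) x := by
    intro x hx
    refine ((hasDerivAt_exp_I_mul ξ x).mul ((h.hasDerivAt_snd x hx).add
      (((hasDerivAt_superpotential hx).ofReal_comp.const_add (I * (ξ : ℂ))).mul
        (h.hasDerivAt_fst x hx)))).congr_deriv ?_
    simp only [hP, partnerPotential, Pi.add_apply, Pi.mul_apply]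
    push_cast
    linear_combination (exp (I * ξ * x) * m x * (ξ : ℂ) ^ 2) * I_sq
  have hdp : ∀ x, 0 ≤ x → HasDerivAt (fun y => ((decayingSolution y)⁻¹ : ℝ) * P y)
      (-((decayingSolution x)⁻¹ : ℝ) * ((ξ : ℂ) ^ 2 * (exp (I * ξ * x) * m x))) x := by
    intro x hx
    have hne := (decayingSolution_pos hx).ne'
    refine (((hasDerivAt_decayingSolution x).inv hne).ofReal_comp.mul (hdP x hx)).congr_deriv ?_
    have hne' : (decayingSolution x : ℂ) ≠ 0 := by exact_mod_cast hne
    simp only [superpotential, Pi.inv_apply]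
    push_cast
    field_simp
    ring
  have hdiff : ‖((decayingSolution X)⁻¹ : ℝ) * P X - ((decayingSolution 0)⁻¹ : ℝ) * P 0‖
      ≤ M * (ξ ^ 2 * K) * ‖X - 0‖ := by
    refine Convex.norm_image_sub_le_of_norm_hasDerivWithin_le (s := Set.Icc 0 X)
      (f := fun y => ((decayingSolution y)⁻¹ : ℝ) * P y)
      (fun x hx => (hdp x hx.1).hasDerivWithinAt) ?_ (convex_Icc 0 X) ⟨le_rfl, hX0.le⟩
      ⟨hX0.le, le_rfl⟩
    intro x hx
    rw [norm_mul, norm_neg, norm_real, norm_mul, norm_pow, norm_real, norm_mul, norm_exp_I_mul,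
      one_mul, Real.norm_of_nonneg hξ.le]
    gcongr
    · exact hM x hx
    · exact (hb ξ m k h x hx.1).1
  have hPX : 1 / (2 * X) ≤ ‖P X‖ := by
    obtain ⟨hb1, hb2, hb3⟩ := hb ξ m k h X hX0.le
    have hKX : K ≤ X / 16 := by linarith
    have hk : ‖k X‖ ≤ 1 / 10 * (1 / X) := by
      refine hb2.trans ?_
      rw [mul_one_div, div_le_div_iff₀ (by positivity) hX0]
      nlinarith [mul_pos hX0 hX0, mul_pos (mul_pos hX0 hX0) hX0]
    have hm : 15 / 16 ≤ ‖m X‖ := by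
      have h1 : K / (1 + X) ^ 2 ≤ 1 / 16 := by
        rw [div_le_iff₀ (by positivity)]
        nlinarith [mul_pos hX0 hX0]
      have h2 : (1 : ℝ) ≤ ‖m X‖ + ‖m X - 1‖ := by
        have := norm_sub_le (m X) (m X - 1)
        simpa using this
      linarith
    have hw : 9 / 10 * (1 / X) ≤ |superpotential X| := by
      have h1 := abs_superpotential_add_inv_le (x := X) (by linarith)
      have h2 : 10 / X ^ 3 ≤ 1 / 10 * (1 / X) := by
        rw [mul_one_div, div_le_div_iff₀ (by positivity) hX0]
        nlinarith [mul_pos hX0 hX0]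
      have h3 := neg_abs_le (superpotential X)
      have h4 := (abs_le.1 h1).2
      linarith
    have hξm : ξ * ‖m X‖ ≤ 1 / 10 * (1 / X) := by
      calc ξ * ‖m X‖ ≤ 1 / (10 * K * X) * K := by gcongr
        _ = _ := by field_simp
    have e : (superpotential X : ℂ) * m X = (k X + (I * ξ + superpotential X) * m X) - k X
        - I * ξ * m X := by ring
    have h1 : ‖(superpotential X : ℂ) * m X‖ ≤
        ‖k X + (I * ξ + superpotential X) * m X‖ + ‖k X‖ + ‖I * ξ * m X‖ := by
      rw [e]
      exact (norm_sub_le _ _).trans (add_le_add_left (norm_sub_le _ _) _)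
    rw [norm_mul, norm_mul, norm_mul, norm_I, one_mul, norm_real, norm_real, Real.norm_eq_abs,
      Real.norm_of_nonneg hξ.le] at h1
    have h2 : 9 / 10 * (1 / X) * (15 / 16) ≤ |superpotential X| * ‖m X‖ := by gcongr
    have h3 : ‖P X‖ = ‖k X + (I * ξ + superpotential X) * m X‖ := by
      simp only [hP, norm_mul, norm_exp_I_mul, one_mul]
    rw [h3, show 1 / (2 * X) = 1 / 2 * (1 / X) by field_simp]
    have h4 : 0 < 1 / X := by positivity
    linarith
  have hpX : c₂ ≤ ‖((decayingSolution X)⁻¹ : ℝ) * P X‖ := by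
    rw [norm_mul, norm_real, norm_inv, Real.norm_of_nonneg hφX.le, hc₂, div_eq_inv_mul]
    gcongr
  have herr : M * (ξ ^ 2 * K) * ‖X - 0‖ ≤ c₂ / 2 := by
    rw [sub_zero, Real.norm_of_nonneg hX0.le]
    rw [le_div_iff₀ (by positivity)] at hξ3
    have h1 : ξ ^ 2 ≤ ξ := by nlinarith
    have h2 : 0 ≤ K * M * X := by positivity
    calc M * (ξ ^ 2 * K) * X = ξ ^ 2 * (K * M * X) := by ring
      _ ≤ ξ * (K * M * X) := by gcongr
      _ ≤ c₂ / 2 := by linarith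
  have hp0 : c₂ / 2 ≤ ‖((decayingSolution 0)⁻¹ : ℝ) * P 0‖ := by
    have := norm_sub_norm_le (((decayingSolution X)⁻¹ : ℝ) * P X)
      (((decayingSolution 0)⁻¹ : ℝ) * P 0)
    linarith
  have hP0 : P 0 = k 0 + (I * ξ + superpotential 0) * m 0 := by
    simp [hP]
  rw [norm_mul, norm_real, norm_inv, Real.norm_of_nonneg hφ0.le, hP0, ← div_eq_inv_mul,
    le_div_iff₀ hφ0] at hp0
  exact hp0

theorem norm_conj_div_self_sub_le {c : ℝ} (hc : 0 < c) {z w : ℂ} (hz : c ≤ ‖z‖) (hw : c ≤ ‖w‖) :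
    ‖(starRingEnd ℂ) z / z - (starRingEnd ℂ) w / w‖ ≤ 2 / c * ‖z - w‖ := by
  have hz0 : z ≠ 0 := norm_pos_iff.1 (hc.trans_le hz)
  have hw0 : w ≠ 0 := norm_pos_iff.1 (hc.trans_le hw)
  have e : (starRingEnd ℂ) z / z - (starRingEnd ℂ) w / w =
      ((starRingEnd ℂ) (z - w) - (starRingEnd ℂ) w / w * (z - w)) / z := by
    rw [map_sub]
    field_simp
    ring
  rw [e, norm_div, div_le_iff₀ (hc.trans_le hz)]
  have h1 : ‖(starRingEnd ℂ) (z - w) - (starRingEnd ℂ) w / w * (z - w)‖ ≤ 2 * ‖z - w‖ := by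
    refine (norm_sub_le _ _).trans ?_
    rw [norm_mul, norm_div, norm_conj, norm_conj, div_self (norm_ne_zero_iff.2 hw0)]
    linarith
  refine h1.trans ?_
  calc 2 * ‖z - w‖ = 2 / c * ‖z - w‖ * c := by field_simp
    _ ≤ _ := by gcongr

theorem norm_conj_div_self_sub_one_le {c : ℝ} (hc : 0 < c) {z : ℂ} (hz : c ≤ ‖z‖) :
    ‖(starRingEnd ℂ) z / z - 1‖ ≤ 1 / c * ‖z - (starRingEnd ℂ) z‖ := by
  have hz0 : z ≠ 0 := norm_pos_iff.1 (hc.trans_le hz)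
  rw [div_sub_one hz0, norm_div, norm_sub_rev, div_eq_inv_mul, one_div]
  gcongr

/-- `iξ f₊(0, ξ)` in terms of the Jost pair of the partner potential. -/
def scaledValue (m k : ℝ → ℂ) (σ : ℝ) : ℂ := k 0 + (I * σ + superpotential 0) * m 0

/-- `iξ ∂ₓf₊(0, ξ)` in terms of the Jost pair of the partner potential. -/
def scaledSlope (m k : ℝ → ℂ) (σ : ℝ) : ℂ :=
  superpotential 0 * scaledValue m k σ - (σ : ℂ) ^ 2 * m 0

theorem conj_scaledValue (m k : ℝ → ℂ) (σ : ℝ) : (starRingEnd ℂ) (scaledValue m k σ) =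
    scaledValue (fun x => (starRingEnd ℂ) (m x)) (fun x => (starRingEnd ℂ) (k x)) (-σ) := by
  simp [scaledValue]

theorem conj_scaledSlope (m k : ℝ → ℂ) (σ : ℝ) : (starRingEnd ℂ) (scaledSlope m k σ) =
    scaledSlope (fun x => (starRingEnd ℂ) (m x)) (fun x => (starRingEnd ℂ) (k x)) (-σ) := by
  simp [scaledSlope, conj_scaledValue]

theorem exists_lipschitz_scaled : ∃ L, 0 < L ∧ ∀ σ τ m₁ k₁ m₂ k₂, |σ| ≤ 1 → |τ| ≤ 1 →
    IsJostPair partnerPotential σ m₁ k₁ → IsJostPair partnerPotential τ m₂ k₂ →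
    ‖scaledValue m₁ k₁ σ - scaledValue m₂ k₂ τ‖ ≤ L * |σ - τ| ∧
    ‖scaledSlope m₁ k₁ σ - scaledSlope m₂ k₂ τ‖ ≤ L * |σ - τ| := by
  obtain ⟨C, hC, hU⟩ := exists_partnerPotential_bound
  obtain ⟨K, hK, hb⟩ := exists_bound_of_isJostPair hC hU
  obtain ⟨L, hL, hl⟩ := exists_lipschitz_of_isJostPair hC hU
  set w : ℝ := |superpotential 0| with hw
  have hw0 : 0 ≤ w := abs_nonneg _
  set L₁ : ℝ := L + (1 + w) * L + K with hL₁
  have hL₁0 : 0 < L₁ := by positivity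
  refine ⟨L₁ + w * L₁ + L + 2 * K, by positivity, fun σ τ m₁ k₁ m₂ k₂ hσ hτ h₁ h₂ => ?_⟩
  obtain ⟨hm, hk⟩ := hl σ τ m₁ k₁ m₂ k₂ h₁ h₂ 0 le_rfl
  have hm₂ := (hb τ m₂ k₂ h₂ 0 le_rfl).1
  have hv : ‖scaledValue m₁ k₁ σ - scaledValue m₂ k₂ τ‖ ≤ L₁ * |σ - τ| := by
    have e : scaledValue m₁ k₁ σ - scaledValue m₂ k₂ τ = (k₁ 0 - k₂ 0) +
        (I * σ + superpotential 0) * (m₁ 0 - m₂ 0) + I * (σ - τ : ℝ) * m₂ 0 := by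
      simp only [scaledValue]
      push_cast
      ring
    have h3 : ‖I * (σ : ℂ) + superpotential 0‖ ≤ 1 + w := by
      refine (norm_add_le _ _).trans ?_
      rw [norm_mul, norm_I, one_mul, norm_real, norm_real]
      exact add_le_add hσ le_rfl
    rw [e]
    refine (norm_add₃_le).trans ?_
    rw [norm_mul, norm_mul, norm_mul I, norm_I, one_mul, norm_real, Real.norm_eq_abs]
    calc ‖k₁ 0 - k₂ 0‖ + ‖I * (σ : ℂ) + superpotential 0‖ * ‖m₁ 0 - m₂ 0‖ + |σ - τ| * ‖m₂ 0‖
        ≤ L * |σ - τ| + (1 + w) * (L * |σ - τ|) + |σ - τ| * K := by gcongr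
      _ = L₁ * |σ - τ| := by rw [hL₁]; ring
  have hs : ‖scaledSlope m₁ k₁ σ - scaledSlope m₂ k₂ τ‖ ≤ (w * L₁ + L + 2 * K) * |σ - τ| := by
    have e : scaledSlope m₁ k₁ σ - scaledSlope m₂ k₂ τ =
        superpotential 0 * (scaledValue m₁ k₁ σ - scaledValue m₂ k₂ τ) +
        -((σ : ℂ) ^ 2 * (m₁ 0 - m₂ 0)) + -((σ + τ : ℝ) * (σ - τ : ℝ) * m₂ 0) := by
      simp only [scaledSlope]
      push_cast
      ring
    have h3 : |σ| ^ 2 ≤ 1 := pow_le_one₀ (abs_nonneg _) hσ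
    have h4 : |σ + τ| ≤ 2 := (abs_add_le _ _).trans (by linarith)
    rw [e]
    refine (norm_add₃_le).trans ?_
    rw [norm_neg, norm_neg, norm_mul, norm_mul, norm_mul, norm_mul, norm_pow, norm_real, norm_real,
      norm_real, norm_real, Real.norm_eq_abs, Real.norm_eq_abs, Real.norm_eq_abs, Real.norm_eq_abs]
    calc w * ‖scaledValue m₁ k₁ σ - scaledValue m₂ k₂ τ‖ + |σ| ^ 2 * ‖m₁ 0 - m₂ 0‖ +
          |σ + τ| * |σ - τ| * ‖m₂ 0‖
        ≤ w * (L₁ * |σ - τ|) + 1 * (L * |σ - τ|) + 2 * |σ - τ| * K := by gcongr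
      _ = _ := by ring
  have hp : 0 ≤ (w * L₁ + L + 2 * K) * |σ - τ| := by positivity
  have hq : 0 ≤ L₁ * |σ - τ| := by positivity
  exact ⟨hv.trans (by linarith), hs.trans (by linarith)⟩

theorem exists_lower_bound_scaled :
    ∃ c ξ₁ : ℝ, 0 < c ∧ 0 < ξ₁ ∧ ξ₁ ≤ 1 ∧ ∀ ξ m k, 0 < ξ → ξ ≤ ξ₁ →
      IsJostPair partnerPotential ξ m k → c ≤ ‖scaledValue m k ξ‖ ∧ c ≤ ‖scaledSlope m k ξ‖ := by
  obtain ⟨C, hC, hU⟩ := exists_partnerPotential_bound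
  obtain ⟨K, hK, hb⟩ := exists_bound_of_isJostPair hC hU
  obtain ⟨c, ξ₁, hc, hξ₁, hξ₁1, hlow⟩ := exists_lower_bound_of_isJostPair
  set w : ℝ := |superpotential 0| with hw
  have hw0 : 0 < w := abs_pos.2 superpotential_zero_ne_zero
  refine ⟨min c (w * c / 2), min ξ₁ (w * c / (2 * K)), by positivity, by positivity,
    (min_le_left _ _).trans hξ₁1, fun ξ m k hξ hξ' h => ?_⟩
  have h1 : c ≤ ‖scaledValue m k ξ‖ := hlow ξ m k hξ (hξ'.trans (min_le_left _ _)) h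
  refine ⟨(min_le_left _ _).trans h1, (min_le_right _ _).trans ?_⟩
  have hξ1 : ξ ≤ 1 := (hξ'.trans (min_le_left _ _)).trans hξ₁1
  have h2 : ξ ^ 2 * K ≤ w * c / 2 := by
    have h3 : ξ ≤ w * c / (2 * K) := hξ'.trans (min_le_right _ _)
    calc ξ ^ 2 * K ≤ ξ * K := by
          gcongr
          nlinarith
      _ ≤ w * c / (2 * K) * K := by gcongr
      _ = _ := by field_simp
  have h3 := norm_sub_norm_le (superpotential 0 * scaledValue m k ξ) ((ξ : ℂ) ^ 2 * m 0)
  rw [norm_mul, norm_mul, norm_pow, norm_real, norm_real, Real.norm_eq_abs,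
    Real.norm_of_nonneg hξ.le] at h3
  have h4 : ξ ^ 2 * ‖m 0‖ ≤ ξ ^ 2 * K := by
    gcongr
    exact (hb ξ m k h 0 le_rfl).1
  have h5 : w * c ≤ w * ‖scaledValue m k ξ‖ := by gcongr
  rw [scaledSlope]
  linarith

/-- The reflection coefficient in terms of the values of `f₊` and `∂ₓf₊` at the origin. -/
theorem Rcoef_eq {f : ℝ → ℝ → ℂ} {ξ : ℝ} {b : ℂ} (hb : HasDerivAt (fun x => f x ξ) b 0) :
    Rcoef f ξ = ((starRingEnd ℂ) (f 0 ξ) * b + (starRingEnd ℂ) b * f 0 ξ) / (-2 * f 0 ξ * b) := by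
  have h1 : HasDerivAt (fun x => f (-x) ξ) (-b) 0 := by
    have hb' : HasDerivAt (fun x => f x ξ) b (-0) := by simpa using hb
    simpa [Function.comp_def] using hb'.scomp (0 : ℝ) (hasDerivAt_neg (0 : ℝ))
  have h2 := hasDerivAt_conj h1
  unfold Rcoef Wr fminus
  rw [hb.deriv, h1.deriv, h2.deriv, neg_zero, map_neg]
  congr 1
  · ring_nf
  · ring

theorem Rcoef_eq_of_scaled {f : ℝ → ℝ → ℂ} {ξ : ℝ} (hξ : 0 < ξ) {b P Q : ℂ}
    (hb : HasDerivAt (fun x => f x ξ) b 0) (hP : I * ξ * f 0 ξ = P) (hQ : I * ξ * b = Q)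
    (hP0 : P ≠ 0) (hQ0 : Q ≠ 0) :
    Rcoef f ξ = ((starRingEnd ℂ) P / P + (starRingEnd ℂ) Q / Q) / 2 := by
  subst hP hQ
  have hξ' : (ξ : ℂ) ≠ 0 := by exact_mod_cast hξ.ne'
  have ha0 : f 0 ξ ≠ 0 := right_ne_zero_of_mul hP0
  have hb0 : b ≠ 0 := right_ne_zero_of_mul hQ0
  rw [Rcoef_eq hb]
  simp only [map_mul, conj_I, conj_ofReal]
  have hI := I_ne_zero
  field_simp
  ring

/-- the improved small-frequency expansion of the reflection
coefficient, `|R(ξ) − 1| ≤ Cξ` and `|ξ R'(ξ)| ≤ Cξ` for `0 < ξ ≤ ξ₀`. -/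
theorem reflection_coefficient_refined
    (fplus : ℝ → ℝ → ℂ)
    (hsmooth : ContDiffOn ℝ (⊤ : ℕ∞) (fun p : ℝ × ℝ => fplus p.1 p.2) {p : ℝ × ℝ | 0 < p.2})
    (hODE : ∀ ξ : ℝ, 0 < ξ → ∀ x : ℝ,
      - deriv (deriv (fun y : ℝ => fplus y ξ)) x
          + ((2 / (1 + x ^ 2) : ℝ) : ℂ) * fplus x ξ = ((ξ : ℂ)) ^ 2 * fplus x ξ)
    (hAsym : ∀ ξ : ℝ, 0 < ξ →
      Tendsto (fun x : ℝ => Complex.exp (-(Complex.I) * x * ξ) * fplus x ξ)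
        atTop (nhds 1))
    (hAsym' : ∀ ξ : ℝ, 0 < ξ →
      Tendsto (fun x : ℝ =>
          Complex.exp (-(Complex.I) * x * ξ) * deriv (fun y : ℝ => fplus y ξ) x)
        atTop (nhds (Complex.I * ξ))) :
    ∃ ξ₀ : ℝ, 0 < ξ₀ ∧ ξ₀ ≤ 1 ∧
    ∃ C : ℝ, 0 < C ∧
      ∀ ξ : ℝ, 0 < ξ → ξ ≤ ξ₀ →
        ‖Rcoef fplus ξ - 1‖ ≤ C * ξ ∧
        ‖(ξ : ℂ) * deriv (Rcoef fplus) ξ‖ ≤ C * ξ := by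
  have hx : ∀ ξ : ℝ, 0 < ξ → ContDiff ℝ (⊤ : ℕ∞) (fun x => fplus x ξ) := by
    intro ξ hξ
    have h : ContDiff ℝ (⊤ : ℕ∞) (fun x : ℝ => (x, ξ)) := by fun_prop
    exact contDiffOn_univ.1 (hsmooth.comp h.contDiffOn fun x _ => hξ)
  have hf : ∀ ξ : ℝ, 0 < ξ → ∀ x, HasDerivAt (fun x => fplus x ξ)
      (deriv (fun y => fplus y ξ) x) x := fun ξ hξ x =>
    ((hx ξ hξ).differentiable (by simp) x).hasDerivAt
  have hg : ∀ ξ : ℝ, 0 < ξ → ∀ x, HasDerivAt (deriv (fun y => fplus y ξ))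
      ((((2 / (1 + x ^ 2) : ℝ) : ℂ) - (ξ : ℂ) ^ 2) * fplus x ξ) x := by
    intro ξ hξ x
    have h := (((contDiff_infty_iff_deriv.1 (hx ξ hξ)).2).differentiable (by simp) x).hasDerivAt
    refine h.congr_deriv ?_
    linear_combination -hODE ξ hξ x
  have hpair := fun ξ (hξ : 0 < ξ) => exists_isJostPair_of_jost hξ (hf ξ hξ) (hg ξ hξ)
    (hAsym ξ hξ) (hAsym' ξ hξ)
  choose! m k hmk hval hslope using hpair
  obtain ⟨L, hL, hlip⟩ := exists_lipschitz_scaled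
  obtain ⟨c, ξ₁, hc, hξ₁, hξ₁1, hlow⟩ := exists_lower_bound_scaled
  have hR : ∀ ξ, 0 < ξ → ξ ≤ ξ₁ → Rcoef fplus ξ =
      ((starRingEnd ℂ) (scaledValue (m ξ) (k ξ) ξ) / scaledValue (m ξ) (k ξ) ξ +
      (starRingEnd ℂ) (scaledSlope (m ξ) (k ξ) ξ) / scaledSlope (m ξ) (k ξ) ξ) / 2 := by
    intro ξ hξ hξ'
    obtain ⟨h1, h2⟩ := hlow ξ _ _ hξ hξ' (hmk ξ hξ)
    have hP : I * ξ * fplus 0 ξ = scaledValue (m ξ) (k ξ) ξ := hval ξ hξ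
    refine Rcoef_eq_of_scaled hξ (hf ξ hξ 0) hP ?_ (norm_pos_iff.1 (hc.trans_le h1))
      (norm_pos_iff.1 (hc.trans_le h2))
    rw [scaledSlope, ← hP, hslope ξ hξ]
    linear_combination (ξ : ℂ) ^ 2 * m ξ 0 * I_sq
  have habs : ∀ ξ, 0 < ξ → ξ ≤ ξ₁ → |ξ| ≤ 1 := fun ξ hξ hξ' => by
    rw [abs_of_pos hξ]
    exact hξ'.trans hξ₁1
  have hRone : ∀ ξ, 0 < ξ → ξ ≤ ξ₁ → ‖Rcoef fplus ξ - 1‖ ≤ 2 / c * L * ξ := by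
    intro ξ hξ hξ'
    obtain ⟨h1, h2⟩ := hlow ξ _ _ hξ hξ' (hmk ξ hξ)
    obtain ⟨h3, h4⟩ := hlip ξ (-ξ) _ _ _ _ (habs ξ hξ hξ') (by rw [abs_neg]; exact habs ξ hξ hξ')
      (hmk ξ hξ) (hmk ξ hξ).conj
    rw [← conj_scaledValue, sub_neg_eq_add, abs_of_pos (add_pos hξ hξ)] at h3
    rw [← conj_scaledSlope, sub_neg_eq_add, abs_of_pos (add_pos hξ hξ)] at h4
    rw [hR ξ hξ hξ', show ∀ z w : ℂ, (z + w) / 2 - 1 = ((z - 1) + (w - 1)) / 2 by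
      intro z w; ring, norm_div, norm_ofNat, div_le_iff₀ two_pos]
    refine (norm_add_le _ _).trans ((add_le_add (norm_conj_div_self_sub_one_le hc h1)
      (norm_conj_div_self_sub_one_le hc h2)).trans ?_)
    calc _ ≤ 1 / c * (L * (ξ + ξ)) + 1 / c * (L * (ξ + ξ)) := by gcongr
      _ = _ := by ring
  have hRlip : ∀ ξ η, 0 < ξ → ξ ≤ ξ₁ → 0 < η → η ≤ ξ₁ →
      ‖Rcoef fplus ξ - Rcoef fplus η‖ ≤ 2 / c * L * ‖ξ - η‖ := by
    intro ξ η hξ hξ' hη hη'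
    obtain ⟨h1, h2⟩ := hlow ξ _ _ hξ hξ' (hmk ξ hξ)
    obtain ⟨h3, h4⟩ := hlow η _ _ hη hη' (hmk η hη)
    obtain ⟨h5, h6⟩ := hlip ξ η _ _ _ _ (habs ξ hξ hξ') (habs η hη hη') (hmk ξ hξ) (hmk η hη)
    rw [hR ξ hξ hξ', hR η hη hη', show ∀ z w z' w' : ℂ, (z + w) / 2 - (z' + w') / 2 =
      ((z - z') + (w - w')) / 2 by intro z w z' w'; ring, norm_div, norm_ofNat,
      div_le_iff₀ two_pos, Real.norm_eq_abs]
    refine (norm_add_le _ _).trans ((add_le_add (norm_conj_div_self_sub_le hc h1 h3)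
      (norm_conj_div_self_sub_le hc h2 h4)).trans ?_)
    calc _ ≤ 2 / c * (L * |ξ - η|) + 2 / c * (L * |ξ - η|) := by gcongr
      _ = _ := by ring
  refine ⟨ξ₁ / 2, by positivity, by linarith, 2 / c * L, by positivity, fun ξ hξ hξ' =>
    ⟨hRone ξ hξ (by linarith), ?_⟩⟩
  rw [norm_mul, norm_real, Real.norm_of_nonneg hξ.le, mul_comm]
  gcongr
  refine norm_deriv_le_of_lip' (by positivity) ?_
  filter_upwards [Ioo_mem_nhds hξ (show ξ < ξ₁ by linarith)] with η hη
  exact hRlip η ξ hη.1 hη.2.le hξ (by linarith)
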